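/- Let $M$ be a topological space and $(F_\lambda)_{\lambda\in M}$, $F_\lambda(y,z)=(\Theta_\lambda(y),R_\lambda(y,z))$, a family of non-degenerate fibered maps of degree $d\ge2$ on $\mathbb{C}^{r+1}\times\mathbb{C}^q$ such that the maps $(\lambda,y,z)\mapsto\Theta_\lambda(y)$ and $(\lambda,y,z)\mapsto R_\lambda(y,z)$ are continuous. Then every $\lambda_0\in M$ admits an open neighbourhood $N$ and $\epsilon\in(0,1]$ such that for all $\lambda\in N$ and all $(y,z)$ with $\|y\|_\infty\le\epsilon\|z\|_\infty$ one has $\|\Theta_\lambda(y)\|_\infty\le(\epsilon/2)\,\|R_\lambda(y,z)\|_\infty$ (so the family map $f(\lambda,x)=(\lambda,f_\lambda(x))$ satisfies $f(N\times U_\epsilon)\subset N\times U_\epsilon$). -/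

import Mathlib

/-- A fibered map of degree `d` on `ℂ^{r+1} × ℂ^q` is a pair `(Θ, R)` where every
coordinate of `Θ : ℂ^{r+1} → ℂ^{r+1}` and of `R : ℂ^{r+1} × ℂ^q → ℂ^q` is a homogeneous
polynomial of degree `d` in the variables `(y, z)`, with `Θ` depending only on `y`. -/
def IsFiberedMap (r q d : ℕ) (Θ : (Fin (r + 1) → ℂ) → (Fin (r + 1) → ℂ))
    (R : (Fin (r + 1) → ℂ) → (Fin q → ℂ) → (Fin q → ℂ)) : Prop :=
  (∃ pΘ : Fin (r + 1) → MvPolynomial (Fin (r + 1)) ℂ,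
      (∀ i, (pΘ i).IsHomogeneous d) ∧ ∀ y i, Θ y i = MvPolynomial.eval y (pΘ i)) ∧
  (∃ pR : Fin q → MvPolynomial (Fin (r + 1) ⊕ Fin q) ℂ,
      (∀ i, (pR i).IsHomogeneous d) ∧
        ∀ y z i, R y z i = MvPolynomial.eval (Sum.elim y z) (pR i))

theorem MvPolynomial.IsHomogeneous.eval_smul {σ R : Type*} [CommSemiring R]
    {p : MvPolynomial σ R} {n : ℕ} (hp : p.IsHomogeneous n) (c : R) (x : σ → R) :
    MvPolynomial.eval (c • x) p = c ^ n * MvPolynomial.eval x p := by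
  rw [MvPolynomial.eval_eq, MvPolynomial.eval_eq, Finset.mul_sum]
  refine Finset.sum_congr rfl fun m hm => ?_
  have hdeg : ∑ i ∈ m.support, m i = n := by
    rw [← Finsupp.degree_apply, Finsupp.degree_eq_weight_one]
    exact hp (MvPolynomial.mem_support_iff.mp hm)
  simp only [Pi.smul_apply, smul_eq_mul, mul_pow, Finset.prod_mul_distrib,
    Finset.prod_pow_eq_pow_sum, hdeg]
  ring

namespace IsFiberedMap

variable {r q d : ℕ} {Θ : (Fin (r + 1) → ℂ) → (Fin (r + 1) → ℂ)}
  {R : (Fin (r + 1) → ℂ) → (Fin q → ℂ) → (Fin q → ℂ)}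

theorem base_smul (h : IsFiberedMap r q d Θ R) (c : ℂ) (y : Fin (r + 1) → ℂ) :
    Θ (c • y) = c ^ d • Θ y := by
  obtain ⟨⟨p, hp, hΘ⟩, -⟩ := h
  ext i
  rw [Pi.smul_apply, hΘ, hΘ, (hp i).eval_smul, smul_eq_mul]

theorem fiber_smul (h : IsFiberedMap r q d Θ R) (c : ℂ) (y : Fin (r + 1) → ℂ) (z : Fin q → ℂ) :
    R (c • y) (c • z) = c ^ d • R y z := by
  obtain ⟨-, p, hp, hR⟩ := h
  ext i
  have hc : Sum.elim (c • y) (c • z) = c • Sum.elim y z := by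
    ext (j | j) <;> rfl
  rw [Pi.smul_apply, hR, hR, hc, (hp i).eval_smul, smul_eq_mul]

theorem base_zero (h : IsFiberedMap r q d Θ R) (hd : d ≠ 0) : Θ 0 = 0 := by
  simpa [hd] using h.base_smul 0 0

end IsFiberedMap

/-- Every nonzero vector is a positive real multiple of a unit vector. -/
theorem exists_eq_norm_smul {E : Type*} [NormedAddCommGroup E] [NormedSpace ℂ E] {x : E}
    (hx : x ≠ 0) : ∃ u : E, ‖u‖ = 1 ∧ x = (‖x‖ : ℂ) • u := by
  have hx' : (‖x‖ : ℂ) ≠ 0 := by simpa using hx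
  exact ⟨(‖x‖ : ℂ)⁻¹ • x, by simp [norm_smul, hx], by rw [smul_inv_smul₀ hx']⟩

/-- for a continuous family `(F_λ)_{λ ∈ M}` of non-degenerate fibered maps
`F_λ(y,z) = (Θ_λ(y), R_λ(y,z))` of degree `d ≥ 2`, every `λ₀ ∈ M` admits an open
neighbourhood `N` and `ε ∈ (0,1]` such that `‖Θ_λ(y)‖ ≤ (ε/2)‖R_λ(y,z)‖` for all
`λ ∈ N` and all `(y,z)` with `‖y‖ ≤ ε‖z‖`; i.e. `f(N × U_ε) ⊂ N × U_ε`. -/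
theorem stmt5 (r q d : ℕ) (hd : 2 ≤ d) (M : Type*) [TopologicalSpace M]
    (Θ : M → (Fin (r + 1) → ℂ) → (Fin (r + 1) → ℂ))
    (R : M → (Fin (r + 1) → ℂ) → (Fin q → ℂ) → (Fin q → ℂ))
    (hfib : ∀ lam : M, IsFiberedMap r q d (Θ lam) (R lam))
    (hnd : ∀ (lam : M) y z, Θ lam y = 0 → R lam y z = 0 → y = 0 ∧ z = 0)
    (hcontΘ : Continuous fun p : M × (Fin (r + 1) → ℂ) × (Fin q → ℂ) => Θ p.1 p.2.1)
    (hcontR : Continuous fun p : M × (Fin (r + 1) → ℂ) × (Fin q → ℂ) =>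
      R p.1 p.2.1 p.2.2) :
    ∀ lam₀ : M, ∃ s : Set M, IsOpen s ∧ lam₀ ∈ s ∧
      ∃ ε : ℝ, 0 < ε ∧ ε ≤ 1 ∧
        ∀ lam ∈ s, ∀ (y : Fin (r + 1) → ℂ) (z : Fin q → ℂ), ‖y‖ ≤ ε * ‖z‖ →
          ‖Θ lam y‖ ≤ (ε / 2) * ‖R lam y z‖ := by
  intro lam₀
  have hd0 : d ≠ 0 := by omega
  have hΘ : Continuous fun p : M × (Fin (r + 1) → ℂ) => Θ p.1 p.2 :=
    hcontΘ.comp (by fun_prop : Continuous fun p : M × (Fin (r + 1) → ℂ) =>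
      (p.1, p.2, (0 : Fin q → ℂ)))
  have hR : Continuous fun p : (M × (Fin (r + 1) → ℂ)) × (Fin q → ℂ) => R p.1.1 p.1.2 p.2 :=
    hcontR.comp (by fun_prop : Continuous fun p : (M × (Fin (r + 1) → ℂ)) × (Fin q → ℂ) =>
      (p.1.1, p.1.2, p.2))
  have hΘ₀ : Continuous (Θ lam₀) :=
    hΘ.comp (by fun_prop : Continuous fun y : Fin (r + 1) → ℂ => (lam₀, y))
  have hR₀ : Continuous (R lam₀ 0) :=
    hR.comp (by fun_prop : Continuous fun z : Fin q → ℂ =>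
      ((lam₀, (0 : Fin (r + 1) → ℂ)), z))
  have hcy := isCompact_sphere (0 : Fin (r + 1) → ℂ) 1
  have hcz := isCompact_sphere (0 : Fin q → ℂ) 1
  obtain ⟨C₀, hC₀⟩ := hcy.exists_bound_of_continuousOn hΘ₀.continuousOn
  obtain ⟨C, hC₀C, hC⟩ : ∃ C, C₀ < C ∧ 0 < C :=
    ⟨max C₀ 0 + 1, by linarith [le_max_left C₀ 0], by linarith [le_max_right C₀ 0]⟩
  have hupper : ∀ᶠ lam in nhds lam₀, ∀ y ∈ Metric.sphere (0 : Fin (r + 1) → ℂ) 1,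
      ‖Θ lam y‖ < C :=
    hcy.eventually_forall_of_forall_eventually fun y hy =>
      hΘ.norm.continuousAt.eventually_lt_const ((hC₀ y hy).trans_lt hC₀C)
  obtain ⟨c₀, hc₀, hc₀R⟩ := hcz.exists_forall_le' (f := fun z => ‖R lam₀ 0 z‖) (a := 0)
    hR₀.norm.continuousOn fun z hz => norm_pos_iff.mpr fun h0 => by
      have hz0 := (hnd lam₀ 0 z ((hfib lam₀).base_zero hd0) h0).2
      simp [hz0] at hz
  obtain ⟨c, hc, hcc₀⟩ := exists_between hc₀
  have hlower : ∀ᶠ p : M × (Fin (r + 1) → ℂ) in nhds (lam₀, 0),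
      ∀ z ∈ Metric.sphere (0 : Fin q → ℂ) 1, c < ‖R p.1 p.2 z‖ :=
    hcz.eventually_forall_of_forall_eventually fun z hz =>
      hR.norm.continuousAt.eventually_const_lt (hcc₀.trans_le (hc₀R z hz))
  rw [nhds_prod_eq] at hlower
  obtain ⟨P, hP, Q, hQ, hPQ⟩ := Filter.eventually_prod_iff.mp hlower
  obtain ⟨δ, hδ, hδQ⟩ := Metric.eventually_nhds_iff.mp hQ
  obtain ⟨s, hs, hso, hls⟩ := eventually_nhds_iff.mp (hupper.and hP)
  obtain ⟨ε, hε, hε'⟩ := exists_between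
    (lt_min one_pos (lt_min hδ (by positivity : 0 < c / (2 * C))))
  obtain ⟨hε1, hεδ, hεc⟩ := by simpa only [lt_min_iff] using hε'
  refine ⟨s, hso, hls, ε, hε, hε1.le, fun lam hlam y z hyz => ?_⟩
  obtain ⟨hΘC, hPlam⟩ := hs lam hlam
  rcases eq_or_ne y 0 with rfl | hy
  · rw [(hfib lam).base_zero hd0, norm_zero]
    positivity
  have hz : z ≠ 0 := by
    rintro rfl
    exact hy (norm_le_zero_iff.mp (by simpa using hyz))
  have hnz : 0 < ‖z‖ := norm_pos_iff.mpr hz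
  have hupper' : ‖Θ lam y‖ ≤ ‖y‖ ^ d * C := by
    obtain ⟨u, hu, hyu⟩ := exists_eq_norm_smul hy
    have hle := (hΘC u (by simpa using hu)).le
    rw [hyu, (hfib lam).base_smul, ← hyu, norm_smul, norm_pow, Complex.norm_real, norm_norm]
    gcongr
  have hlower' : ‖z‖ ^ d * c ≤ ‖R lam y z‖ := by
    obtain ⟨u, hu, hzu⟩ := exists_eq_norm_smul hz
    have hnz' : (‖z‖ : ℂ) ≠ 0 := by simpa using hz
    have hyw : y = (‖z‖ : ℂ) • ((‖z‖ : ℂ)⁻¹ • y) := (smul_inv_smul₀ hnz' y).symm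
    have hw : dist ((‖z‖ : ℂ)⁻¹ • y) 0 < δ := by
      rw [dist_zero_right, norm_smul, norm_inv, Complex.norm_real, norm_norm, inv_mul_eq_div]
      exact ((div_le_iff₀ hnz).mpr hyz).trans_lt hεδ
    have hle := (hPQ hPlam (hδQ hw) u (by simpa using hu)).le
    have hRyz : R lam y z = (‖z‖ : ℂ) ^ d • R lam ((‖z‖ : ℂ)⁻¹ • y) u := by
      rw [← (hfib lam).fiber_smul, ← hyw, ← hzu]
    rw [hRyz, norm_smul, norm_pow, Complex.norm_real, norm_norm]
    gcongr
  have hεd : ε ^ d ≤ ε * ε := by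
    rw [← sq]
    exact pow_le_pow_of_le_one hε.le hε1.le hd
  have hεC : ε * C ≤ c / 2 := by
    rw [lt_div_iff₀ (by positivity)] at hεc
    linarith
  calc ‖Θ lam y‖ ≤ ‖y‖ ^ d * C := hupper'
    _ ≤ (ε * ‖z‖) ^ d * C := by gcongr
    _ = ε ^ d * (‖z‖ ^ d * C) := by ring
    _ ≤ (ε * ε) * (‖z‖ ^ d * C) := by gcongr
    _ = ε * ‖z‖ ^ d * (ε * C) := by ring
    _ ≤ ε * ‖z‖ ^ d * (c / 2) := by gcongr
    _ = ε / 2 * (‖z‖ ^ d * c) := by ring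
    _ ≤ ε / 2 * ‖R lam y z‖ := by gcongr
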